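/- Let p be a prime and let A be a subgroup of a finite group G. Then |Irr_{p'}(G)| ≤ |G:A| · |Irr_{p'}(A)|. -/

import Mathlib

open Module CategoryTheory

noncomputable section

/-- `χ : G → ℂ` is the character of an irreducible complex representation of `G`
of degree `d`. -/
def IsIrrCharDeg (G : Type) [Group G] (χ : G → ℂ) (d : ℕ) : Prop :=
  ∃ V : FDRep ℂ G, Simple V ∧ χ = FDRep.character V ∧ finrank ℂ V = d

/-- `χ : G → ℂ` is an irreducible complex character of `G`. -/
def IsIrrChar (G : Type) [Group G] (χ : G → ℂ) : Prop :=
  ∃ d, IsIrrCharDeg G χ d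

/-- The set of irreducible complex characters of `G` whose degree is not divisible by `p`. -/
def IrrP' (p : ℕ) (G : Type) [Group G] : Set (G → ℂ) :=
  {χ | ∃ d, IsIrrCharDeg G χ d ∧ ¬ p ∣ d}

/-- `acd_{p'}(G)`: the average of the degrees of the irreducible complex characters of `G`
whose degree is not divisible by `p`.  (For a character `χ`, its degree equals `χ 1`,
a nonnegative real.) -/
def acdP' (p : ℕ) (G : Type) [Group G] : ℝ :=
  (∑ᶠ χ ∈ IrrP' p G, (χ 1).re) / (IrrP' p G).ncard

lemma irr_of_simple {G : Type} [Group G] [Finite G] (V : FDRep ℂ G) [Simple V] :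
    Representation.IsIrreducible (FDRep.ρ V) := by
  classical
  let _ := Fintype.ofFinite G
  have hid : (𝟙 V) ≠ 0 := id_nonzero V
  have nt : Nontrivial V := by
    by_contra hn
    rw [not_nontrivial_iff_subsingleton] at hn
    apply hid
    ext x
    exact Subsingleton.elim (α := V) _ _
  refine { exists_pair_ne := ⟨⊥, ⊤, ?_⟩, eq_bot_or_eq_top := ?_ }
  · intro h
    have := congrArg Subrepresentation.toSubmodule h
    exact bot_ne_top (α := Submodule ℂ V) this
  · intro U
    let f : FDRep.of U.toRepresentation ⟶ V :=
      ⟨InducedCategory.homMk (ModuleCat.ofHom U.toSubmodule.subtype), fun g => by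
        ext x; rfl⟩
    have hf : ∀ x : U.toSubmodule, f.hom.hom.hom x = x.1 := fun x => rfl
    have : Mono f := by
      refine ⟨fun {Z} a b hab => ?_⟩
      ext x
      exact congrArg (fun q : Z ⟶ V => q.hom.hom.hom x) hab
    by_cases h0 : f = 0
    · left
      apply Subrepresentation.toSubmodule_injective
      change U.toSubmodule = ⊥
      rw [eq_bot_iff]
      intro x hx
      exact congrArg (fun q : FDRep.of U.toRepresentation ⟶ V => q.hom.hom.hom ⟨x, hx⟩) h0
    · right
      have hi : IsIso f := isIso_of_mono_of_nonzero h0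
      apply Subrepresentation.toSubmodule_injective
      change U.toSubmodule = ⊤
      rw [eq_top_iff]
      intro x _
      have := congrArg (fun q : V ⟶ V => q.hom.hom.hom x) (IsIso.inv_hom_id f)
      have h2 : ((inv f).hom.hom.hom x : U.toSubmodule).1 = x := this
      rw [← h2]
      exact Subtype.property _

lemma simple_of_irr {G : Type} [Group G] [Finite G] {V : Type} [AddCommGroup V] [Module ℂ V]
    [Module.Finite ℂ V]
    (ρ : Representation ℂ G V) [ρ.IsIrreducible] : Simple (FDRep.of ρ) := by
  classical
  let _ := Fintype.ofFinite G
  have := invertibleOfNonzero (NeZero.ne (Nat.card G : ℂ))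
  rw [FDRep.simple_iff_char_is_norm_one]
  have h := Representation.char_orthonormal ρ ρ
  rw [if_pos ⟨Representation.Equiv.refl ρ⟩, inv_mul_eq_one₀ (NeZero.ne _)] at h
  exact h.symm

/-- The isotypic projector (up to a scalar). -/
lemma proj_eq {G : Type} [Group G] [Fintype G] {V W : Type} [AddCommGroup V] [Module ℂ V]
    [Module.Finite ℂ V] [AddCommGroup W] [Module ℂ W] [Module.Finite ℂ W]
    (ρ : Representation ℂ G V) [ρ.IsIrreducible] 
    (σ : Representation ℂ G W) [σ.IsIrreducible] :
    ∃ c : ℂ, (∀ w, ∑ h : G, ρ.character h⁻¹ • σ h w = c • w) ∧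
      (ρ.character ≠ σ.character → c = 0) ∧ (ρ.character = σ.character → c ≠ 0) := by
  classical
  have := invertibleOfNonzero (NeZero.ne (Nat.card G : ℂ))
  let T : W →ₗ[ℂ] W := ∑ h : G, ρ.character h⁻¹ • σ h
  have hT : ∀ w, T w = ∑ h : G, ρ.character h⁻¹ • σ h w := fun w => by simp [T]
  let T' : Representation.IntertwiningMap σ σ := ⟨T, fun g => by
    ext w
    simp only [LinearMap.comp_apply, hT, map_sum, map_smul, ← Module.End.mul_apply, ← map_mul]
    refine Fintype.sum_equiv ((Equiv.mulRight g).trans (Equiv.mulLeft g⁻¹)) _ _ fun h => ?_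
    have : ρ.character (g⁻¹ * (h * g))⁻¹ = ρ.character h⁻¹ := by
      rw [← ρ.char_conj h⁻¹ g⁻¹]; congr 1; group
    simp only [Equiv.trans_apply, Equiv.coe_mulRight, Equiv.coe_mulLeft, this]
    congr 3
    group⟩
  obtain ⟨c, hc⟩ := (Representation.IsIrreducible.algebraMap_intertwiningMap_bijective_of_isAlgClosed (ρ := σ)).2 T'
  have hc' : ∀ w, T w = c • w := fun w => by
    have := congrArg (fun q : Representation.IntertwiningMap σ σ => q w) hc
    exact this.symm
  have htr : c * finrank ℂ W = ∑ g : G, σ.character g * ρ.character g⁻¹ := by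
    have h1 : T = c • LinearMap.id := by ext w; simp [hc']
    have h2 : LinearMap.trace ℂ W T = c * finrank ℂ W := by
      rw [h1]; simp
    rw [← h2]
    simp [T, Representation.character, mul_comm]
  have hn : Nontrivial W := by
    by_contra hn
    rw [not_nontrivial_iff_subsingleton] at hn
    exact bot_ne_top (α := Subrepresentation σ)
      (Subrepresentation.toSubmodule_injective (Subsingleton.elim _ _))
  have hd : (finrank ℂ W : ℂ) ≠ 0 := by
    exact_mod_cast (finrank_pos (R := ℂ) (M := W)).ne'
  refine ⟨c, fun w => by rw [← hT, hc'], ?_, ?_⟩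
  · intro hne
    have h := Representation.char_orthonormal σ ρ
    rw [if_neg (fun ⟨e⟩ => hne (Representation.char_iso e)), ← htr] at h
    simpa [hd] using h
  · intro he h0
    have h := Representation.char_orthonormal σ σ
    rw [if_pos ⟨Representation.Equiv.refl σ⟩] at h
    rw [he, h0] at htr
    rw [← htr] at h
    simp at h

lemma key {G : Type} [Group G] [Finite G] (A : Subgroup G) {ι : Type} [Fintype ι]
    (V : ι → Type) [∀ i, AddCommGroup (V i)] [∀ i, Module ℂ (V i)] [∀ i, Module.Finite ℂ (V i)]
    (ρ : ∀ i, Representation ℂ G (V i)) [∀ i, (ρ i).IsIrreducible]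
    (hinj : Function.Injective fun i => (ρ i).character)
    {W : Type} [AddCommGroup W] [Module ℂ W] [Module.Finite ℂ W]
    (σ : Representation ℂ A W) (φ : ∀ i, V i →ₗ[ℂ] W) (hφ : ∀ i, φ i ≠ 0)
    (hA : ∀ i (a : A) v, φ i (ρ i a v) = σ a (φ i v)) :
    ∑ i, finrank ℂ (V i) ≤ A.index * finrank ℂ W := by
  classical
  let _ := Fintype.ofFinite G
  let Q := Quotient (QuotientGroup.rightRel A)
  let _ : Fintype Q := Fintype.ofFinite _
  have hQ : Fintype.card Q = A.index := by
    rw [← Nat.card_eq_fintype_card, Subgroup.index,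
      Nat.card_congr (QuotientGroup.quotientRightRelEquivQuotientLeftRel A)]
  let Φ : (∀ i, V i) →ₗ[ℂ] (Q → W) :=
    LinearMap.pi fun q => ∑ i, φ i ∘ₗ ρ i q.out ∘ₗ LinearMap.proj i
  have hΦ : ∀ v q, Φ v q = ∑ i, φ i (ρ i q.out (v i)) := fun v q => by simp [Φ]
  have hker : ∀ v, Φ v = 0 → v = 0 := by
    intro v hv
    have h1 : ∀ g : G, ∑ i, φ i (ρ i g (v i)) = 0 := by
      intro g
      have hq := congrFun hv (Quotient.mk'' g : Q)
      rw [hΦ] at hq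
      have hr : (QuotientGroup.rightRel A) (Quotient.mk'' g : Q).out g :=
        Quotient.mk_out (s := QuotientGroup.rightRel A) g
      rw [QuotientGroup.rightRel_apply] at hr
      set t := (Quotient.mk'' g : Q).out
      have : ∀ i, φ i (ρ i g (v i)) = σ ⟨_, hr⟩ (φ i (ρ i t (v i))) := by
        intro i
        rw [← hA, ← Module.End.mul_apply, ← map_mul]
        simp
      simp only [this, ← map_sum, hq]
      simp
    funext i
    obtain hc := fun j => proj_eq (ρ i) (ρ j)
    choose c hc1 hc2 hc3 using hc
    have h2 : ∀ g : G, φ i (ρ i g (v i)) = 0 := by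
      intro g
      have h3 : ∑ h : G, (ρ i).character h⁻¹ • ∑ j, φ j (ρ j (g * h) (v j)) = 0 := by
        simp only [h1, smul_zero, Finset.sum_const_zero]
      simp only [Finset.smul_sum] at h3
      rw [Finset.sum_comm] at h3
      have h4 : ∀ j, ∑ h : G, (ρ i).character h⁻¹ • φ j (ρ j (g * h) (v j))
          = c j • φ j (ρ j g (v j)) := by
        intro j
        rw [← map_smul, ← map_smul, ← hc1]
        simp
      simp only [h4] at h3
      rw [Finset.sum_eq_single i] at h3
      · exact (smul_eq_zero.mp h3).resolve_left (hc3 i rfl)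
      · intro j _ hj
        rw [hc2 j (fun h => hj (hinj h).symm), zero_smul]
      · simp
    let U : Subrepresentation (ρ i) :=
      { toSubmodule := ⨅ g : G, LinearMap.ker (φ i ∘ₗ ρ i g)
        apply_mem_toSubmodule := by
          intro g w hw
          simp only [Submodule.mem_iInf, LinearMap.mem_ker, LinearMap.comp_apply] at hw ⊢
          intro h
          rw [← Module.End.mul_apply, ← map_mul]
          exact hw _ }
    have hU : ∀ w, w ∈ U.toSubmodule ↔ ∀ g, φ i (ρ i g w) = 0 := by
      intro w; simp [U]
    rcases eq_bot_or_eq_top U with h | h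
    · have : v i ∈ U.toSubmodule := (hU _).2 h2
      rw [h] at this
      exact this
    · exfalso
      apply hφ i
      ext w
      have hw : w ∈ U.toSubmodule := by rw [h]; exact Submodule.mem_top
      simpa using (hU w).1 hw 1
  have hi : Function.Injective Φ := by
    rw [← LinearMap.ker_eq_bot, eq_bot_iff]
    exact fun v hv => hker v hv
  have := LinearMap.finrank_le_finrank_of_injective hi
  rw [finrank_pi_fintype, finrank_pi_fintype] at this
  simpa [hQ] using this

lemma exists_constituent (p : ℕ) {A : Type} [Group A] [Finite A] (n : ℕ) :
    ∀ {U : Type} [AddCommGroup U] [Module ℂ U] [Module.Finite ℂ U]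
    (ρ : Representation ℂ A U), finrank ℂ U = n → ¬ p ∣ n →
    ∃ W : FDRep ℂ A, Simple W ∧ ¬ p ∣ finrank ℂ W ∧ ∃ φ : U →ₗ[ℂ] W, φ ≠ 0 ∧
      ∀ a u, φ (ρ a u) = W.ρ a (φ u) := by
  induction n using Nat.strong_induction_on with
  | _ n ih =>
  intro U _ _ _ ρ hn hp
  have nt : Nontrivial U := by
    by_contra h
    rw [not_nontrivial_iff_subsingleton] at h
    rw [finrank_zero_of_subsingleton] at hn
    exact hp (hn ▸ dvd_zero p)
  by_cases hirr : ρ.IsIrreducible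
  · refine ⟨FDRep.of ρ, simple_of_irr ρ, hn ▸ hp, LinearMap.id, ?_, fun a u => rfl⟩
    intro h
    obtain ⟨x, hx⟩ := exists_ne (0 : U)
    exact hx (congrArg (fun q : U →ₗ[ℂ] U => q x) h)
  have : ∃ S : Subrepresentation ρ, S ≠ ⊥ ∧ S ≠ ⊤ := by
    by_contra! h
    apply hirr
    refine { exists_pair_ne := ⟨⊥, ⊤, ?_⟩, eq_bot_or_eq_top := fun S => ?_ }
    · intro h
      exact bot_ne_top (α := Submodule ℂ U) (congrArg Subrepresentation.toSubmodule h)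
    · by_cases hS : S = ⊥
      · exact Or.inl hS
      · exact Or.inr (h S hS)
  obtain ⟨S, hS0, hS1⟩ := this
  have hsemi : Representation.IsSemisimpleRepresentation ρ := inferInstance
  obtain ⟨S', hS'⟩ := hsemi.exists_isCompl S
  have hc : IsCompl S.toSubmodule S'.toSubmodule := by
    constructor
    · rw [disjoint_iff, ← Subrepresentation.toSubmodule_inf, hS'.inf_eq_bot]; rfl
    · rw [codisjoint_iff, ← Subrepresentation.toSubmodule_sup, hS'.sup_eq_top]; rfl
  have hsum := Submodule.finrank_add_eq_of_isCompl hc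
  -- common step
  have step : ∀ S S' : Subrepresentation ρ, IsCompl S.toSubmodule S'.toSubmodule → S ≠ ⊤ →
      ¬ p ∣ finrank ℂ S.toSubmodule → ∃ W : FDRep ℂ A, Simple W ∧ ¬ p ∣ finrank ℂ W ∧
      ∃ φ : U →ₗ[ℂ] W, φ ≠ 0 ∧ ∀ a u, φ (ρ a u) = W.ρ a (φ u) := by
    intro S S' hc hS hp
    have hlt : finrank ℂ S.toSubmodule < n := by
      rw [← hn]
      refine Submodule.finrank_lt (lt_top_iff_ne_top.2 fun h => hS ?_).ne
      exact Subrepresentation.toSubmodule_injective h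
    obtain ⟨W, hW, hpW, φ, hφ, hA⟩ := ih _ hlt S.toRepresentation rfl hp
    let π := Submodule.projectionOnto _ _ hc
    have hπ : ∀ a u, π (ρ a u) = S.toRepresentation a (π u) := by
      intro a u
      obtain ⟨x, y, rfl⟩ : ∃ (x : S.toSubmodule) (y : S'.toSubmodule), u = x + y := by
        obtain ⟨x, hx, y, hy, h⟩ := Submodule.mem_sup.1 (hc.sup_eq_top ▸ Submodule.mem_top (x := u))
        exact ⟨⟨x, hx⟩, ⟨y, hy⟩, h.symm⟩
      have e1 : ρ a (x + y) = (S.toRepresentation a x : U) + (S'.toRepresentation a y : U) := by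
        rw [map_add]; rfl
      rw [e1]
      simp [π]
    refine ⟨W, hW, hpW, φ ∘ₗ π, ?_, fun a u => ?_⟩
    · intro h
      apply hφ
      ext x
      have := congrArg (fun q : U →ₗ[ℂ] W => q x) h
      simpa [π] using this
    · simp only [LinearMap.comp_apply, hπ, hA]
  by_cases h : p ∣ finrank ℂ S.toSubmodule
  · refine step S' S hc.symm ?_ ?_
    · rintro rfl
      exact hS0 (by simpa using hS'.inf_eq_bot)
    · intro h'
      exact hp (hn ▸ hsum ▸ dvd_add h h')
  · exact step S S' hc hS1 h

lemma count {G : Type} [Group G] [Finite G] (A : Subgroup G) {W : Type} [AddCommGroup W]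
    [Module ℂ W] [Module.Finite ℂ W] (σ : Representation ℂ A W) (t : Finset (G → ℂ)) (m : ℕ)
    (h : ∀ χ ∈ t, ∃ V : FDRep ℂ G, Simple V ∧ χ = FDRep.character V ∧ m ≤ finrank ℂ V ∧
      ∃ φ : V →ₗ[ℂ] W, φ ≠ 0 ∧ ∀ (a : A) v, φ (V.ρ a v) = σ a (φ v)) :
    t.card * m ≤ A.index * finrank ℂ W := by
  have h' : ∀ χ : t, _ := fun χ => h χ.1 χ.2
  choose V hV hχ hm φ hφ hA using h'
  have hirr : ∀ χ : t, Representation.IsIrreducible (FDRep.ρ (V χ)) := fun χ => by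
    have := hV χ
    exact irr_of_simple _
  have := key A (fun χ : t => (V χ : Type)) (fun χ => FDRep.ρ (V χ)) (fun χ ψ he => by
    apply Subtype.ext
    rw [hχ χ, hχ ψ]
    exact he) σ φ hφ hA
  refine le_trans ?_ this
  have h2 := Finset.card_nsmul_le_sum (Finset.univ : Finset t) (fun χ => finrank ℂ (V χ)) m
    (fun χ _ => hm χ)
  simpa using h2

lemma nontrivial_of_irr {G : Type} [Group G] {W : Type} [AddCommGroup W] [Module ℂ W]
    (σ : Representation ℂ G W) [σ.IsIrreducible] : Nontrivial W := by
  by_contra hn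
  rw [not_nontrivial_iff_subsingleton] at hn
  exact bot_ne_top (α := Subrepresentation σ)
    (Subrepresentation.toSubmodule_injective (Subsingleton.elim _ _))

lemma IrrP'_finite (p : ℕ) (G : Type) [Group G] [Finite G] : (IrrP' p G).Finite := by
  by_contra hinf
  obtain ⟨t, ht, hcard⟩ := Set.Infinite.exists_subset_card_eq hinf (Nat.card G + 1)
  have := count (⊥ : Subgroup G) (W := ℂ) (Representation.trivial ℂ (⊥ : Subgroup G) ℂ) t 1 (by
    intro χ hχ
    obtain ⟨d, ⟨V, hV, hc, hd⟩, hp⟩ := ht hχ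
    have := irr_of_simple V
    have := nontrivial_of_irr (FDRep.ρ V)
    obtain ⟨x, hx⟩ := exists_ne (0 : V)
    obtain ⟨f, hf⟩ : ∃ f : V →ₗ[ℂ] ℂ, f x ≠ 0 := by
      by_contra! hall
      exact hx ((Module.forall_dual_apply_eq_zero_iff ℂ x).1 hall)
    refine ⟨V, hV, hc, finrank_pos, f, ?_, ?_⟩
    · rintro rfl
      exact hf rfl
    · rintro ⟨a, ha⟩ v
      rw [Subgroup.mem_bot] at ha
      subst ha
      simp)
  rw [Subgroup.index_bot, finrank_self, hcard] at this
  omega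

lemma iso_of_char {A : Type} [Group A] [Finite A] (W W' : FDRep ℂ A) [Simple W] [Simple W']
    (h : W.character = W'.character) : Nonempty (W ≅ W') := by
  classical
  let _ := Fintype.ofFinite A
  have := invertibleOfNonzero (NeZero.ne (Nat.card A : ℂ))
  by_contra hn
  have h1 := FDRep.char_orthonormal W W'
  have h2 := FDRep.char_orthonormal W W
  rw [if_neg hn, ← h] at h1
  rw [if_pos ⟨Iso.refl W⟩, h1] at h2
  exact zero_ne_one h2

/-- Lemma 9.1: for a subgroup `A ≤ G`, `|Irr_{p'}(G)| ≤ |G:A| ⬝ |Irr_{p'}(A)|`. -/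
theorem card_IrrP'_le
    (p : ℕ) (hp : p.Prime) (G : Type) [Group G] [Finite G] (A : Subgroup G) :
    (IrrP' p G).ncard ≤ A.index * (IrrP' p ↥A).ncard := by
  classical
  have hex : ∀ χ ∈ IrrP' p G, ∃ W : FDRep ℂ A, Simple W ∧ ¬ p ∣ finrank ℂ W ∧
      ∃ V : FDRep ℂ G, Simple V ∧ χ = FDRep.character V ∧
      ∃ φ : V →ₗ[ℂ] W, φ ≠ 0 ∧ ∀ (a : A) v, φ (V.ρ a v) = W.ρ a (φ v) := by
    rintro χ ⟨d, ⟨V, hV, hc, hd⟩, hpd⟩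
    obtain ⟨W, hW, hpW, φ, hφ, hA⟩ := exists_constituent p (A := A) _
      ((FDRep.ρ V).comp A.subtype : Representation ℂ A V) rfl (hd.symm ▸ hpd)
    exact ⟨W, hW, hpW, V, hV, hc, φ, hφ, hA⟩
  have : Nonempty (FDRep ℂ A) := ⟨FDRep.of (Representation.trivial ℂ A ℂ)⟩
  choose! W hW hpW hrest using hex
  let f : (G → ℂ) → (A → ℂ) := fun χ => FDRep.character (W χ)
  have hG := IrrP'_finite p G
  have hAf := IrrP'_finite p A
  rw [Set.ncard_eq_toFinset_card _ hG, Set.ncard_eq_toFinset_card _ hAf]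
  refine Finset.card_le_mul_card_image_of_maps_to (f := f) ?_ _ ?_
  · intro χ hχ
    simp only [Set.Finite.coe_toFinset, Set.Finite.mem_toFinset] at hχ ⊢
    exact ⟨_, ⟨W χ, hW χ hχ, rfl, rfl⟩, hpW χ hχ⟩
  · intro θ hθ
    rw [Set.Finite.mem_toFinset] at hθ
    obtain ⟨d, ⟨W₀, hW₀, hc₀, hd₀⟩, hpd⟩ := hθ
    have irr₀ := irr_of_simple W₀
    have nt₀ := nontrivial_of_irr (FDRep.ρ W₀)
    have hpos : 0 < finrank ℂ W₀ := finrank_pos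
    refine Nat.le_of_mul_le_mul_right (count A (FDRep.ρ W₀) _ (finrank ℂ W₀) ?_) hpos
    intro χ hχ
    rw [Finset.mem_filter, Set.Finite.mem_toFinset] at hχ
    obtain ⟨hχ, hfχ⟩ := hχ
    obtain ⟨V, hV, hc, φ, hφ, hA⟩ := hrest χ hχ
    have := hW χ hχ
    obtain ⟨e⟩ := iso_of_char (W χ) W₀ (hfχ.trans hc₀)
    let e' := FDRep.isoToLinearEquiv e
    have he : ∀ a w, e' (FDRep.ρ (W χ) a w) = FDRep.ρ W₀ a (e' w) := by
      intro a w
      rw [FDRep.Iso.conj_ρ e a]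
      simp [e', LinearEquiv.conj_apply]
    let ψ : V →ₗ[ℂ] W₀ := e'.toLinearMap ∘ₗ φ
    have hψA : ∀ (a : A) v, ψ (V.ρ a v) = W₀.ρ a (ψ v) := by
      intro a v
      simp only [ψ, LinearMap.comp_apply, hA, LinearEquiv.coe_coe, he]
    have hψ : ψ ≠ 0 := by
      intro h0
      apply hφ
      ext v
      apply e'.injective
      rw [LinearMap.zero_apply, map_zero]
      exact congrArg (fun q : V →ₗ[ℂ] W₀ => q v) h0
    refine ⟨V, hV, hc, ?_, ψ, hψ, hψA⟩
    let Ψ : Representation.IntertwiningMap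
        ((FDRep.ρ V).comp A.subtype : Representation ℂ A V) (FDRep.ρ W₀) :=
      ⟨ψ, fun a => LinearMap.ext fun v => hψA a v⟩
    rcases Representation.IsIrreducible.surjective_or_eq_zero Ψ with h | h
    · exact LinearMap.finrank_le_finrank_of_surjective (f := ψ) h
    · exact absurd (congrArg Representation.IntertwiningMap.toLinearMap h) hψ
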